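/- arXiv:1407.8045 — 6 statements merged into one kernel-verified Lean document; each statement's English description precedes it below -/
import Mathlib

section
/- Let D be a digraph on a finite vertex set. The minimum cardinality of a dijoin of D is equal to the maximum number of pairwise disjoint directed cuts of D (Lucchesi–Younger theorem). -/
/-- A directed cut in the digraph with edge set `E`: for some vertex set `X`,
every edge of `E` between `X` and its complement is directed from `X` to the
complement, there is at least one such edge, and `C` is the set of all edges
from `X` to the complement. -/
def IsDicut {V : Type*} [DecidableEq V] (E C : Finset (V × V)) : Prop :=
  ∃ X : Finset V,
    (∀ e ∈ E, ¬(e.1 ∉ X ∧ e.2 ∈ X)) ∧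
    C = E.filter (fun e => e.1 ∈ X ∧ e.2 ∉ X) ∧
    C.Nonempty

/-- A dijoin: a set of edges of `E` meeting every directed cut. -/
def IsDijoin {V : Type*} [DecidableEq V] (E J : Finset (V × V)) : Prop :=
  J ⊆ E ∧ ∀ C : Finset (V × V), IsDicut E C → ∃ e ∈ J, e ∈ C

namespace LY

open Finset

variable {V : Type*} [DecidableEq V]

/-- The edges leaving `X`. -/
def cut (E : Finset (V × V)) (X : Finset V) : Finset (V × V) :=
  E.filter (fun e => e.1 ∈ X ∧ e.2 ∉ X)

/-- `X` induces a directed cut. -/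
def Good (E : Finset (V × V)) (X : Finset V) : Prop :=
  (∀ e ∈ E, ¬(e.1 ∉ X ∧ e.2 ∈ X)) ∧ (cut E X).Nonempty

/-- A family of directed cuts with capacities `w`. -/
def Pack (E : Finset (V × V)) {ι : Type*} [Fintype ι] (F : ι → Finset V)
    (w : V × V → ℕ) : Prop :=
  (∀ i, Good E (F i)) ∧ ∀ e ∈ E, ∑ i, (if e ∈ cut E (F i) then 1 else 0) ≤ w e

def HasPack (E : Finset (V × V)) (w : V × V → ℕ) (k : ℕ) : Prop :=
  ∃ F : Fin k → Finset V, Pack E F w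

theorem mem_cut {E : Finset (V × V)} {X : Finset V} {e : V × V} :
    e ∈ cut E X ↔ e ∈ E ∧ e.1 ∈ X ∧ e.2 ∉ X := by
  simp [cut]

theorem Pack.comp {E : Finset (V × V)} {ι κ : Type*} [Fintype ι] [Fintype κ]
    {F : ι → Finset V} {w : V × V → ℕ} (h : Pack E F w) (g : κ → ι)
    (hg : Function.Injective g) : Pack E (F ∘ g) w := by
  refine ⟨fun i => h.1 _, fun e he => le_trans ?_ (h.2 e he)⟩
  have := Finset.sum_map (Finset.univ : Finset κ) ⟨g, hg⟩
    (fun i => if e ∈ cut E (F i) then 1 else 0)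
  simp only [Function.Embedding.coeFn_mk] at this
  simp only [Function.comp]
  rw [← this]
  exact Finset.sum_le_sum_of_subset (Finset.subset_univ _)

theorem Pack.hasPack {E : Finset (V × V)} {ι : Type*} [Fintype ι]
    {F : ι → Finset V} {w : V × V → ℕ} (h : Pack E F w) {k : ℕ}
    (hk : k ≤ Fintype.card ι) : HasPack E w k := by
  have e := (Fintype.equivFin ι).symm
  exact ⟨_, h.comp (fun i : Fin k => e (Fin.castLE hk i))
    (e.injective.comp (Fin.castLE_injective hk))⟩

theorem HasPack.mono {E : Finset (V × V)} {w w' : V × V → ℕ} {k k' : ℕ}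
    (h : HasPack E w k) (hw : ∀ e ∈ E, w e ≤ w' e) (hk : k' ≤ k) : HasPack E w' k' := by
  obtain ⟨F, hF⟩ := h
  have : Pack E F w' := ⟨hF.1, fun e he => (hF.2 e he).trans (hw e he)⟩
  exact this.hasPack (by simpa using hk)

theorem HasPack.le {E : Finset (V × V)} {w : V × V → ℕ} {k : ℕ}
    (h : HasPack E w k) : k ≤ ∑ e ∈ E, w e := by
  obtain ⟨F, hF⟩ := h
  calc k = ∑ i : Fin k, 1 := by simp
    _ ≤ ∑ i : Fin k, ∑ e ∈ E, (if e ∈ cut E (F i) then 1 else 0) := by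
        apply Finset.sum_le_sum
        intro i _
        obtain ⟨e, he⟩ := (hF.1 i).2
        have h1 := Finset.single_le_sum (s := E)
          (f := fun e => if e ∈ cut E (F i) then 1 else 0) (fun _ _ => Nat.zero_le _)
          (mem_cut.1 he).1
        simpa [he] using h1
    _ = ∑ e ∈ E, ∑ i : Fin k, (if e ∈ cut E (F i) then 1 else 0) := Finset.sum_comm
    _ ≤ _ := Finset.sum_le_sum hF.2

/-- Cross-free families. -/
def CF (E : Finset (V × V)) {ι : Type*} (F : ι → Finset V) : Prop :=
  ∀ i j, F i ⊆ F j ∨ F j ⊆ F i ∨ cut E (F i ∩ F j) = ∅ ∨ cut E (F i ∪ F j) = ∅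

theorem sum_update2 {ι : Type*} [Fintype ι] [DecidableEq ι] {α : Type*} (F : ι → α)
    (i j : ι) (hij : i ≠ j) (A B : α) (f : α → ℕ) :
    ∑ t, f (Function.update (Function.update F i A) j B t) + (f (F i) + f (F j)) =
      ∑ t, f (F t) + (f A + f B) := by
  have h1 : ∀ G : ι → α, ∑ t, f (G t) =
      f (G i) + (f (G j) + ∑ t ∈ (Finset.univ.erase i).erase j, f (G t)) := by
    intro G
    rw [Finset.add_sum_erase _ (fun t => f (G t)) (by simp [hij.symm]),
      Finset.add_sum_erase _ (fun t => f (G t)) (by simp)]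
  rw [h1, h1 F]
  have h2 : ∑ t ∈ (Finset.univ.erase i).erase j,
      f (Function.update (Function.update F i A) j B t) =
      ∑ t ∈ (Finset.univ.erase i).erase j, f (F t) := by
    apply Finset.sum_congr rfl
    intro t ht
    simp only [Finset.mem_erase] at ht
    rw [Function.update_of_ne ht.1, Function.update_of_ne ht.2.1]
  rw [h2]
  simp [Function.update_of_ne hij]
  ring

theorem uncross [Fintype V] {E : Finset (V × V)} {w : V × V → ℕ} {k : ℕ}
    (h : HasPack E w k) : ∃ F : Fin k → Finset V, Pack E F w ∧ CF E F := by
  obtain ⟨F, hF, hmax⟩ := Set.exists_max_image {F : Fin k → Finset V | Pack E F w}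
    (fun F => ∑ i, (F i).card ^ 2) (Set.toFinite _) h
  refine ⟨F, hF, ?_⟩
  intro i j
  by_contra! hc
  obtain ⟨h1, h2, h3, h4⟩ := hc
  have hij : i ≠ j := by
    rintro rfl
    exact h1 (Finset.Subset.refl _)
  have oi := (hF.1 i).1
  have oj := (hF.1 j).1
  have hP : Pack E (Function.update (Function.update F i (F i ∩ F j)) j (F i ∪ F j)) w := by
    constructor
    · intro t
      by_cases htj : t = j
      · subst htj
        rw [Function.update_self]
        refine ⟨?_, h4⟩
        intro e he
        have := oi e he
        have := oj e he
        simp only [Finset.mem_union]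
        tauto
      · rw [Function.update_of_ne htj]
        by_cases hti : t = i
        · subst hti
          rw [Function.update_self]
          refine ⟨?_, h3⟩
          intro e he
          have := oi e he
          have := oj e he
          simp only [Finset.mem_inter]
          tauto
        · rw [Function.update_of_ne hti]
          exact hF.1 t
    · intro e he
      have h5 := sum_update2 F i j hij (F i ∩ F j) (F i ∪ F j)
        (fun X => if e ∈ cut E X then 1 else 0)
      have h6 : ((if e ∈ cut E (F i) then 1 else 0) + (if e ∈ cut E (F j) then 1 else 0) : ℕ) =
        (if e ∈ cut E (F i ∩ F j) then 1 else 0) + (if e ∈ cut E (F i ∪ F j) then 1 else 0) := by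
        have := oi e he
        have := oj e he
        simp only [mem_cut, he, Finset.mem_union, Finset.mem_inter, true_and]
        by_cases a1 : e.1 ∈ F i <;> by_cases a2 : e.1 ∈ F j <;>
        by_cases a3 : e.2 ∈ F i <;> by_cases a4 : e.2 ∈ F j <;> simp_all
      have := hF.2 e he
      omega
  have h7 := hmax _ hP
  have h5 := sum_update2 F i j hij (F i ∩ F j) (F i ∪ F j) (fun X => X.card ^ 2)
  have c1 := Finset.card_union_add_card_inter (F i) (F j)
  have c2 : (F i ∩ F j).card < (F i).card :=
    Finset.card_lt_card (Finset.ssubset_iff_subset_ne.2 ⟨Finset.inter_subset_left, fun h => h1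
      (Finset.inter_eq_left.1 h)⟩)
  have c3 : (F i ∩ F j).card < (F j).card :=
    Finset.card_lt_card (Finset.ssubset_iff_subset_ne.2 ⟨Finset.inter_subset_right, fun h => h2
      (Finset.inter_eq_right.1 h)⟩)
  have h8 : (F i ∩ F j).card ^ 2 + (F i ∪ F j).card ^ 2 ≤ (F i).card ^ 2 + (F j).card ^ 2 := by
    omega
  generalize (F i ∩ F j).card = a at *
  generalize (F i ∪ F j).card = b at *
  generalize (F i).card = c at *
  generalize (F j).card = d at *
  obtain ⟨p, rfl⟩ := Nat.exists_eq_add_of_lt c2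
  obtain ⟨q, rfl⟩ := Nat.exists_eq_add_of_lt c3
  have : b = a + p + q + 2 := by omega
  subst this
  nlinarith [Nat.zero_le (p * q)]

/-- `j` is above `i` in the tree order. -/
def Above (E : Finset (V × V)) {k : ℕ} (F : Fin k → Finset V) (i j : Fin k) : Prop :=
  F i ⊂ F j ∨ (F i = F j ∧ j < i) ∨ cut E (F i ∪ F j) = ∅

open Classical in
theorem divide [Fintype V] {E : Finset (V × V)} {w : V × V → ℕ} {k m N : ℕ} (hN : 0 < N)
    (h : HasPack E (fun e => N * w e) m) (hm : N * k < m) : HasPack E w (k + 1) := by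
  obtain ⟨F, hF, hcf⟩ := uncross h
  let r : Fin m → ℕ := fun i => (Finset.univ.filter (fun j => Above E F i j)).card
  obtain ⟨c, hc, hck⟩ := Finset.exists_lt_card_fiber_of_mul_lt_card_of_maps_to
    (s := (Finset.univ : Finset (Fin m))) (t := Finset.range N) (f := fun i => r i % N) (n := k)
    (fun i _ => Finset.mem_range.2 (Nat.mod_lt _ hN)) (by simpa using hm)
  have key : Pack E (fun i : {i : Fin m // r i % N = c} => F i) w := by
    refine ⟨fun i => hF.1 _, fun e he => ?_⟩
    have hload := hF.2 e he
    rw [← Finset.card_filter] at hload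
    beta_reduce at hload
    set S : Finset (Fin m) := Finset.univ.filter (fun i => e ∈ cut E (F i)) with hS
    set a : ℕ := (Finset.univ.filter (fun j : Fin m => e.2 ∈ F j)).card with ha
    have hmS : ∀ i, i ∈ S ↔ e.1 ∈ F i ∧ e.2 ∉ F i := by
      intro i; simp [hS, mem_cut, he]
    have hcomp : ∀ i ∈ S, ∀ j ∈ S, F i ⊆ F j ∨ F j ⊆ F i := by
      intro i hi j hj
      rw [hmS] at hi hj
      rcases hcf i j with h | h | h | h
      · exact Or.inl h
      · exact Or.inr h
      · exfalso
        have : e ∈ cut E (F i ∩ F j) := by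
          rw [mem_cut]; simp [he, hi, hj]
        simp [h] at this
      · exfalso
        have : e ∈ cut E (F i ∪ F j) := by
          rw [mem_cut]; simp [he, hi, hj]
        simp [h] at this
    have hnu : ∀ i ∈ S, ∀ j, e.2 ∉ F j → cut E (F i ∪ F j) ≠ ∅ := by
      intro i hi j hj h
      rw [hmS] at hi
      have : e ∈ cut E (F i ∪ F j) := by
        rw [mem_cut]; simp [he, hi, hj]
      simp [h] at this
    have hr : ∀ i ∈ S, r i = a + (S.filter (fun j => Above E F i j)).card := by
      intro i hi
      have hi' := (hmS i).1 hi
      rw [ha, ← Finset.card_union_of_disjoint]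
      · refine congrArg Finset.card ?_
        ext j
        simp only [Finset.mem_filter, Finset.mem_univ, true_and, Finset.mem_union, hmS]
        have hoj := (hF.1 j).1 e he
        by_cases hv : e.2 ∈ F j
        · have hu : e.1 ∈ F j := by by_contra hu; exact hoj ⟨hu, hv⟩
          simp only [hv, true_or, iff_true]
          rcases hcf i j with h | h | h | h
          · left
            refine Finset.ssubset_iff_subset_ne.2 ⟨h, fun h' => hi'.2 (h' ▸ hv)⟩
          · exact absurd (h hv) hi'.2
          · exfalso
            have : e ∈ cut E (F i ∩ F j) := by
              rw [mem_cut]; simp [he, hi', hu]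
            simp [h] at this
          · exact Or.inr (Or.inr h)
        · have h0 := hnu i hi j hv
          by_cases hu : e.1 ∈ F j
          · simp [hv, hu]
          · simp only [hv, hu, false_and, or_false, iff_false]
            rintro (h | h | h)
            · exact hu (h.1 hi'.1)
            · exact hu (h.1 ▸ hi'.1)
            · exact h0 h
      · rw [Finset.disjoint_left]
        intro j hj hj'
        simp only [Finset.mem_filter, Finset.mem_univ, true_and, hmS] at hj hj'
        exact hj'.1.2 hj
    have habove : ∀ i ∈ S, ∀ j ∈ S, (Above E F i j ↔ F i ⊂ F j ∨ (F i = F j ∧ j < i)) := by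
      intro i hi j hj
      have := hnu i hi j ((hmS j).1 hj).2
      simp [Above, this]
    have hlt : ∀ i ∈ S, ∀ j ∈ S, Above E F i j → r j < r i := by
      intro i hi j hj hij
      rw [hr i hi, hr j hj]
      apply Nat.add_lt_add_left
      apply Finset.card_lt_card
      rw [Finset.ssubset_iff_of_subset]
      · refine ⟨j, by simp [hj, hij], ?_⟩
        simp only [Finset.mem_filter, hj, true_and]
        rw [habove j hj j hj]
        rintro (h | h)
        · exact h.2 h.1
        · exact lt_irrefl _ h.2
      · intro t ht
        simp only [Finset.mem_filter] at ht ⊢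
        refine ⟨ht.1, ?_⟩
        have h1 := (habove _ hj _ ht.1).1 ht.2
        have h2 := (habove _ hi _ hj).1 hij
        rw [habove _ hi _ ht.1]
        rcases h1 with h1 | h1 <;> rcases h2 with h2 | h2
        · exact Or.inl (h2.trans h1)
        · left; rw [h2.1]; exact h1
        · left; rw [← h1.1]; exact h2
        · right; exact ⟨h2.1.trans h1.1, h1.2.trans h2.2⟩
    have hinj : Set.InjOn r S := by
      intro i hi j hj hij
      by_contra hne
      have hi1 : i ∈ S := hi
      have hj1 : j ∈ S := hj
      have : Above E F i j ∨ Above E F j i := by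
        rw [habove _ hi1 _ hj1, habove _ hj1 _ hi1]
        by_cases hEq : F i = F j
        · rcases lt_or_gt_of_ne hne with h | h
          · right; right; exact ⟨hEq.symm, h⟩
          · left; right; exact ⟨hEq, h⟩
        · rcases hcomp i hi1 j hj1 with h | h
          · left; left; exact Finset.ssubset_iff_subset_ne.2 ⟨h, hEq⟩
          · right; left; exact Finset.ssubset_iff_subset_ne.2 ⟨h, fun h => hEq h.symm⟩
      rcases this with h | h
      · have := hlt _ hi1 _ hj1 h; omega
      · have := hlt _ hj1 _ hi1 h; omega
    have hrange : ∀ i ∈ S, a ≤ r i ∧ r i < a + N * w e := by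
      intro i hi
      rw [hr i hi]
      refine ⟨by omega, ?_⟩
      have : (S.filter (fun j => Above E F i j)).card < S.card := by
        apply Finset.card_lt_card
        rw [Finset.ssubset_iff_of_subset (Finset.filter_subset _ _)]
        refine ⟨i, hi, ?_⟩
        simp only [Finset.mem_filter, hi, true_and]
        rw [habove i hi i hi]
        rintro (h | h)
        · exact h.2 h.1
        · exact lt_irrefl _ h.2
      omega
    have hcount : ((Finset.Ico a (a + N * w e)).filter (fun x => x % N = c)).card ≤ w e := by
      have h1 : ∀ b, ((Finset.Ico a (a + N * b)).filter (fun x => x % N = c)).card ≤ b := by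
        intro b
        induction b with
        | zero => simp
        | succ b ih =>
          have h2 : Finset.Ico a (a + N * (b + 1)) =
              Finset.Ico a (a + N * b) ∪ Finset.Ico (a + N * b) (a + N * b + N) := by
            rw [Finset.Ico_union_Ico_eq_Ico (by omega) (by omega)]
            congr 1
            ring
          rw [h2, Finset.filter_union]
          refine (Finset.card_union_le _ _).trans ?_
          have h3 : ((Finset.Ico (a + N * b) (a + N * b + N)).filter
              (fun x => x % N = c)).card ≤ 1 := by
            rw [Finset.card_le_one]
            intro x hx y hy
            simp only [Finset.mem_filter, Finset.mem_Ico] at hx hy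
            have hmod : x ≡ y [MOD N] := hx.2.trans hy.2.symm
            exact Nat.ModEq.eq_of_abs_lt hmod (by rw [abs_lt]; constructor <;> omega)
          omega
      exact h1 _
    refine le_trans ?_ hcount
    rw [← Finset.card_filter]
    apply Finset.card_le_card_of_injOn (fun i => r i.1)
    · intro i hi
      have hiS : i.1 ∈ S := by
        have := (Finset.mem_filter.1 hi).2
        simpa [hS] using this
      have := hrange _ hiS
      simp only [Finset.coe_filter, Finset.mem_Ico, Set.mem_ofPred_eq]
      exact ⟨this, i.2⟩
    · intro i hi j hj hij
      have hiS : i.1 ∈ S := by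
        have := (Finset.mem_filter.1 hi).2
        simpa [hS] using this
      have hjS : j.1 ∈ S := by
        have := (Finset.mem_filter.1 hj).2
        simpa [hS] using this
      exact Subtype.ext (hinj hiS hjS hij)
  apply key.hasPack
  rw [Fintype.card_subtype]
  exact hck

theorem isDicut_iff {E C : Finset (V × V)} :
    IsDicut E C ↔ ∃ X, Good E X ∧ C = cut E X := by
  constructor
  · rintro ⟨X, h1, h2, h3⟩
    refine ⟨X, ⟨h1, ?_⟩, h2⟩
    have : C = cut E X := h2
    rwa [← this]
  · rintro ⟨X, h1, h2⟩
    refine ⟨X, h1.1, h2, ?_⟩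
    rw [h2]
    exact h1.2

open Classical in
theorem weighted [Fintype V] (E : Finset (V × V)) : ∀ (n : ℕ) (w : V × V → ℕ),
    ∑ e ∈ E, w e = n → ∃ J k, IsDijoin E J ∧ HasPack E w k ∧ ∑ e ∈ J, w e ≤ k := by
  intro n
  induction n using Nat.strong_induction_on with
  | _ n ih =>
  intro w hw
  have h0 : HasPack E w 0 := ⟨Fin.elim0, fun i => i.elim0, by simp⟩
  obtain ⟨k, hk, hkmax⟩ : ∃ k, HasPack E w k ∧ ¬ HasPack E w (k + 1) := by
    by_contra! hc
    have : ∀ k, HasPack E w k := fun k => Nat.rec h0 (fun k hk => hc k hk) k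
    have := (this (n + 1)).le
    omega
  by_cases hk0 : k = 0
  · subst hk0
    refine ⟨E.filter (fun e => w e = 0), 0, ⟨Finset.filter_subset _ _, ?_⟩, h0, ?_⟩
    · intro C hC
      obtain ⟨X, hX, rfl⟩ := isDicut_iff.1 hC
      by_contra! hc
      apply hkmax
      refine ⟨fun _ => X, fun _ => hX, fun e he => ?_⟩
      by_cases hec : e ∈ cut E X
      · have : w e ≠ 0 := fun h => hc e (by simp [he, h]) hec
        simp [hec]; omega
      · simp [hec]
    · rw [Finset.sum_eq_zero]
      intro e he
      exact (Finset.mem_filter.1 he).2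
  set S := E.filter (fun e => 0 < w e) with hS
  by_cases hex : ∃ f ∈ S, ¬ HasPack E (fun e => w e - if e = f then 1 else 0) k
  · obtain ⟨f, hf, hnf⟩ := hex
    have hf' := Finset.mem_filter.1 hf
    have hlt : ∑ e ∈ E, (w e - if e = f then 1 else 0) < n := by
      rw [← hw]
      apply Finset.sum_lt_sum
      · intro e _; omega
      · exact ⟨f, hf'.1, by simp; omega⟩
    obtain ⟨J, k', hJ, hP, hle⟩ := ih _ hlt _ rfl
    refine ⟨J, k, hJ, hk, ?_⟩
    have hk' : k' < k := by
      by_contra! hc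
      exact hnf (hP.mono (fun _ _ => le_rfl) hc)
    have : ∑ e ∈ J, w e ≤ ∑ e ∈ J, (w e - if e = f then 1 else 0) + 1 := by
      calc ∑ e ∈ J, w e ≤ ∑ e ∈ J, ((w e - if e = f then 1 else 0) + if e = f then 1 else 0) := by
            apply Finset.sum_le_sum; intro e _; omega
        _ = ∑ e ∈ J, (w e - if e = f then 1 else 0) + ∑ e ∈ J, (if e = f then 1 else 0) :=
            Finset.sum_add_distrib
        _ ≤ _ := by
            gcongr
            rw [Finset.sum_ite_eq']
            split_ifs <;> simp
    omega
  · exfalso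
    push Not at hex
    have hex' : ∀ f : S, HasPack E (fun e => w e - if e = f.1 then 1 else 0) k :=
      fun f => hex f.1 f.2
    choose G hG using hex'
    obtain ⟨F0, hF0⟩ := hk
    have i0 : Fin k := ⟨0, by omega⟩
    have hload0 : ∀ e ∈ E, (if e ∈ cut E (F0 i0) then 1 else 0) ≤ w e := by
      intro e he
      exact (Finset.single_le_sum (f := fun i => if e ∈ cut E (F0 i) then 1 else 0)
        (fun _ _ => Nat.zero_le _) (Finset.mem_univ i0)).trans (hF0.2 e he)
    have hSpos : 0 < S.card := by
      obtain ⟨e, he⟩ := (hF0.1 i0).2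
      have heE := (mem_cut.1 he).1
      have := hload0 e heE
      rw [if_pos he] at this
      exact Finset.card_pos.2 ⟨e, Finset.mem_filter.2 ⟨heE, this⟩⟩
    apply hkmax
    apply divide (N := S.card) (m := S.card * k + 1) hSpos _ (by omega)
    have hP : Pack E (Sum.elim (fun p : S × Fin k => G p.1 p.2) (fun _ : Unit => F0 i0))
        (fun e => S.card * w e) := by
      constructor
      · rintro (p | u)
        · exact (hG p.1).1 p.2
        · exact hF0.1 i0
      · intro e he
        suffices hs : ∑ f : S, ∑ i : Fin k, (if e ∈ cut E (G f i) then 1 else 0) +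
            (if e ∈ cut E (F0 i0) then 1 else 0) ≤ S.card * w e by
          refine le_trans (le_of_eq ?_) hs
          rw [Fintype.sum_sum_type, Fintype.sum_prod_type]
          refine congrArg₂ (· + ·) rfl ?_
          exact Fintype.sum_unique (ι := Unit) _
        have h1 : ∑ f : S, ∑ i : Fin k, (if e ∈ cut E (G f i) then 1 else 0) ≤
            ∑ f : S, (w e - if e = f.1 then 1 else 0) :=
          Finset.sum_le_sum (fun f _ => (hG f).2 e he)
        have h2 := hload0 e he
        by_cases hwe : w e = 0
        · simp only [hwe, Nat.zero_sub, Finset.sum_const_zero] at h1 h2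
          omega
        · have heS : e ∈ S := Finset.mem_filter.2 ⟨he, by omega⟩
          have h3 : ∑ f : S, (w e - if e = f.1 then 1 else 0) + 1 = S.card * w e := by
            have h4 : ∑ f : S, (if e = f.1 then 1 else 0) = 1 := by
              rw [Finset.sum_coe_sort S (fun f => if e = f then 1 else 0)]
              simp [heS]
            rw [← h4, ← Finset.sum_add_distrib]
            rw [Finset.sum_congr rfl (g := fun _ => w e)]
            · simp
            · intro f _
              split_ifs <;> omega
          have h5 : (if e ∈ cut E (F0 i0) then 1 else 0) ≤ 1 := by split_ifs <;> simp
          omega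
    exact hP.hasPack (by simp)

end LY

/-- **Lucchesi–Younger theorem.** In a digraph on a finite vertex set, the
minimum cardinality of a dijoin equals the maximum number of pairwise disjoint
directed cuts. -/
theorem lucchesi_younger {V : Type*} [Fintype V] [DecidableEq V]
    (E : Finset (V × V)) (hE : ∀ e ∈ E, e.1 ≠ e.2) :
    sInf {k : ℕ | ∃ J : Finset (V × V), IsDijoin E J ∧ J.card = k} =
    sSup {k : ℕ | ∃ 𝒞 : Finset (Finset (V × V)), (∀ C ∈ 𝒞, IsDicut E C) ∧
      (𝒞 : Set (Finset (V × V))).Pairwise Disjoint ∧ 𝒞.card = k} := by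
  classical
  obtain ⟨J, k, hJ, ⟨F, hF⟩, hle⟩ := LY.weighted E _ (fun _ => 1) rfl
  have hdisj : ∀ i j, i ≠ j → Disjoint (LY.cut E (F i)) (LY.cut E (F j)) := by
    intro i j hij
    rw [Finset.disjoint_left]
    intro e hi hj
    have h := hF.2 e (LY.mem_cut.1 hi).1
    rw [← Finset.card_filter, Finset.card_le_one] at h
    exact hij (h i (by simp [hi]) j (by simp [hj]))
  have hinj : Function.Injective (fun i => LY.cut E (F i)) := by
    intro i j hij
    by_contra hne
    have h := hdisj i j hne
    simp only at hij
    rw [hij, disjoint_self] at h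
    exact (hF.1 j).2.ne_empty h
  have hweak : ∀ (J' : Finset (V × V)) (𝒞 : Finset (Finset (V × V))), IsDijoin E J' →
      (∀ C ∈ 𝒞, IsDicut E C) → (𝒞 : Set (Finset (V × V))).Pairwise Disjoint →
      𝒞.card ≤ J'.card := by
    intro J' 𝒞 hJ' h𝒞 hd
    have hg' : ∀ C : Finset (V × V), ∃ s : Option (V × V),
        IsDicut E C → ∃ e, s = some e ∧ e ∈ J' ∧ e ∈ C := by
      intro C
      by_cases hC : IsDicut E C
      · obtain ⟨e, h1, h2⟩ := hJ'.2 C hC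
        exact ⟨some e, fun _ => ⟨e, rfl, h1, h2⟩⟩
      · exact ⟨none, fun h => absurd h hC⟩
    choose g hg using hg'
    rw [← Finset.card_map Function.Embedding.some (s := J')]
    apply Finset.card_le_card_of_injOn g
    · intro C hC
      obtain ⟨e, h1, h2, h3⟩ := hg C (h𝒞 C hC)
      simp [h1, h2]
    · intro C hC C' hC' hEq
      by_contra hne
      have h := hd hC hC' hne
      rw [Finset.disjoint_left] at h
      obtain ⟨e, h1, h2, h3⟩ := hg C (h𝒞 C hC)
      obtain ⟨e', h1', h2', h3'⟩ := hg C' (h𝒞 C' hC')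
      rw [h1, h1'] at hEq
      obtain rfl := Option.some.inj hEq
      exact h h3 h3'
  have hk : ∃ 𝒞 : Finset (Finset (V × V)), (∀ C ∈ 𝒞, IsDicut E C) ∧
      (𝒞 : Set (Finset (V × V))).Pairwise Disjoint ∧ 𝒞.card = k := by
    refine ⟨Finset.univ.image (fun i => LY.cut E (F i)), ?_, ?_, ?_⟩
    · intro C hC
      obtain ⟨i, _, rfl⟩ := Finset.mem_image.1 hC
      exact LY.isDicut_iff.2 ⟨F i, hF.1 i, rfl⟩
    · intro C hC C' hC' hne
      obtain ⟨i, _, rfl⟩ := Finset.mem_image.1 (Finset.mem_coe.1 hC)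
      obtain ⟨j, _, rfl⟩ := Finset.mem_image.1 (Finset.mem_coe.1 hC')
      exact hdisj i j (fun h => hne (by rw [h]))
    · rw [Finset.card_image_of_injective _ hinj]
      simp
  obtain ⟨𝒞, h1, h2, h3⟩ := hk
  have hJk : J.card = k := by
    have := hweak J 𝒞 hJ h1 h2
    simp at hle
    omega
  have hmin : IsLeast {k : ℕ | ∃ J : Finset (V × V), IsDijoin E J ∧ J.card = k} k := by
    refine ⟨⟨J, hJ, hJk⟩, ?_⟩
    rintro _ ⟨J', hJ', rfl⟩
    rw [← h3]
    exact hweak J' 𝒞 hJ' h1 h2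
  have hmax : IsGreatest {k : ℕ | ∃ 𝒞 : Finset (Finset (V × V)), (∀ C ∈ 𝒞, IsDicut E C) ∧
      (𝒞 : Set (Finset (V × V))).Pairwise Disjoint ∧ 𝒞.card = k} k := by
    refine ⟨⟨𝒞, h1, h2, h3⟩, ?_⟩
    rintro _ ⟨𝒞', h1', h2', rfl⟩
    rw [← hJk]
    exact hweak J 𝒞' hJ h1' h2'
  rw [hmin.csInf_eq, hmax.csSup_eq]
end

section
/- Let V be a finite set of n vertices and let F be a set of m edges on V, each edge joining two distinct vertices. Then there exists a vertex cover of F of size at most (n + m)/3. -/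
theorem cover_aux {V : Type*} [DecidableEq V] (k : ℕ) :
    ∀ (F : Finset (V × V)) (W : Finset V), F.card ≤ k →
      (∀ e ∈ F, e.1 ≠ e.2 ∧ e.1 ∈ W ∧ e.2 ∈ W) →
      ∃ S : Finset V, (∀ e ∈ F, e.1 ∈ S ∨ e.2 ∈ S) ∧ 3 * S.card ≤ W.card + F.card := by
  induction k with
  | zero =>
    intro F W hk _
    have : F = ∅ := Finset.card_eq_zero.mp (by omega)
    subst this
    exact ⟨∅, by simp, by simp⟩
  | succ k ih =>
    intro F W hk hF
    by_cases h : ∃ v, 2 ≤ (F.filter (fun e => e.1 = v ∨ e.2 = v)).card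
    · obtain ⟨v, hv⟩ := h
      have hsplit := Finset.card_filter_add_card_filter_not (s := F)
        (fun e => e.1 = v ∨ e.2 = v)
      have hvW : v ∈ W := by
        obtain ⟨e, he⟩ := Finset.card_pos.mp (lt_of_lt_of_le Nat.zero_lt_two hv)
        rw [Finset.mem_filter] at he
        have := hF e he.1
        rcases he.2 with rfl | rfl
        · exact this.2.1
        · exact this.2.2
      have hW := Finset.card_erase_add_one hvW
      obtain ⟨S, hS, hc⟩ := ih (F.filter (fun e => ¬ (e.1 = v ∨ e.2 = v))) (W.erase v)
        (by omega) (by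
          intro e he
          rw [Finset.mem_filter] at he
          have := hF e he.1
          simp only [Finset.mem_erase]
          tauto)
      refine ⟨insert v S, ?_, ?_⟩
      · intro e he
        simp only [Finset.mem_insert]
        by_cases hh : e.1 = v ∨ e.2 = v
        · tauto
        · have := hS e (Finset.mem_filter.mpr ⟨he, hh⟩)
          tauto
      · have := Finset.card_insert_le v S
        omega
    · push Not at h
      rcases F.eq_empty_or_nonempty with rfl | ⟨⟨a, b⟩, hab⟩
      · exact ⟨∅, by simp, by simp⟩
      have huniq : ∀ v, ∀ e ∈ F, ∀ f ∈ F, (e.1 = v ∨ e.2 = v) → (f.1 = v ∨ f.2 = v) → e = f := by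
        intro v e he f hf h1 h2
        exact Finset.card_le_one.mp (Nat.le_of_lt_succ (h v)) e
          (Finset.mem_filter.mpr ⟨he, h1⟩) f (Finset.mem_filter.mpr ⟨hf, h2⟩)
      obtain ⟨hne, ha, hb⟩ := hF _ hab
      simp only at hne ha hb
      have hW1 := Finset.card_erase_add_one ha
      have hW2 := Finset.card_erase_add_one (Finset.mem_erase.mpr ⟨hne.symm, hb⟩)
      have hF1 := Finset.card_erase_add_one hab
      obtain ⟨S, hS, hc⟩ := ih (F.erase (a, b)) ((W.erase a).erase b) (by omega) (by
          intro e he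
          rw [Finset.mem_erase] at he
          have := hF e he.2
          have h1 := huniq a e he.2 _ hab
          have h2 := huniq b e he.2 _ hab
          simp only [Finset.mem_erase]
          simp only [true_or, or_true] at h1 h2
          tauto)
      refine ⟨insert a S, ?_, ?_⟩
      · intro e he
        simp only [Finset.mem_insert]
        by_cases hh : e = (a, b)
        · subst hh; simp
        · have := hS e (Finset.mem_erase.mpr ⟨hh, he⟩)
          tauto
      · have := Finset.card_insert_le a S
        omega

/-- Any set `F` of `m` edges (pairs of distinct vertices) on an `n`-element
vertex set has a vertex cover of size at most `(n + m) / 3`. -/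
theorem exists_small_vertex_cover {V : Type*} [Fintype V] [DecidableEq V]
    (F : Finset (V × V)) (hF : ∀ e ∈ F, e.1 ≠ e.2) :
    ∃ S : Finset V, (∀ e ∈ F, e.1 ∈ S ∨ e.2 ∈ S) ∧
      (S.card : ℝ) ≤ ((Fintype.card V : ℝ) + (F.card : ℝ)) / 3 := by
  obtain ⟨S, hS, hc⟩ := cover_aux F.card F Finset.univ le_rfl
    (fun e he => ⟨hF e he, Finset.mem_univ _, Finset.mem_univ _⟩)
  refine ⟨S, hS, ?_⟩
  rw [Finset.card_univ] at hc
  have : (3 * S.card : ℝ) ≤ (Fintype.card V : ℝ) + (F.card : ℝ) := by exact_mod_cast hc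
  linarith
end

section
/- Let D be a digraph on n vertices that has a feedback arc set of size f. Then D has an acyclic set of size at least (2n − f)/3. -/
/-- The edges of the cyclic sequence of vertices `l` (with wraparound):
consecutive pairs `(v₁,v₂), ..., (v_{k-1},v_k), (v_k,v₁)`. -/
def cycleEdges {V : Type*} (l : List V) : List (V × V) := l.zip (l.rotate 1)

/-- `l` is a directed cycle of the digraph with edge set `E`: a nonempty cyclic
sequence of distinct vertices all of whose consecutive edges (with wraparound)
belong to `E`. -/
def IsDicycle {V : Type*} (E : Finset (V × V)) (l : List V) : Prop :=
  l ≠ [] ∧ l.Nodup ∧ ∀ e ∈ cycleEdges l, e ∈ E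

/-- `F` is a feedback arc set: every directed cycle contains an edge of `F`. -/
def IsFAS {V : Type*} (E F : Finset (V × V)) : Prop :=
  ∀ l : List V, IsDicycle E l → ∃ e ∈ cycleEdges l, e ∈ F

/-- `A` is an acyclic set: the subdigraph induced on `A` has no directed cycle. -/
def IsAcyclicSet {V : Type*} (E : Finset (V × V)) (A : Finset V) : Prop :=
  ∀ l : List V, (∀ v ∈ l, v ∈ A) → ¬ IsDicycle E l

lemma greedy_aux {V : Type*} [DecidableEq V] (F : Finset (V × V))
    (hl : ∀ e ∈ F, e.1 ≠ e.2) : ∀ (n : ℕ) (S : Finset V), S.card = n →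
    ∃ A ⊆ S, (∀ e ∈ F, ¬ (e.1 ∈ A ∧ e.2 ∈ A)) ∧
      2 * S.card ≤ 3 * A.card + (F.filter (fun e => e.1 ∈ S ∧ e.2 ∈ S)).card := by
  intro n
  induction n using Nat.strong_induction_on with
  | _ n ih =>
  intro S hS
  rcases S.eq_empty_or_nonempty with rfl | ⟨v, hv⟩
  · exact ⟨∅, by simp, by simp, by simp⟩
  have hpos : 0 < S.card := Finset.card_pos.mpr ⟨v, hv⟩
  have hce := Finset.card_erase_of_mem hv
  obtain ⟨A, hAS, hA, hc⟩ := ih (S.erase v).card (by omega) (S.erase v) rfl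
  set G := F.filter (fun e => e.1 ∈ S ∧ e.2 ∈ S) with hG
  have hsplit := Finset.card_filter_add_card_filter_not (s := G) (fun e => e.1 = v ∨ e.2 = v)
  have hGe : F.filter (fun e => e.1 ∈ S.erase v ∧ e.2 ∈ S.erase v)
      = G.filter (fun e => ¬ (e.1 = v ∨ e.2 = v)) := by
    ext e
    simp only [hG, Finset.mem_filter, Finset.mem_erase]
    tauto
  rw [hGe] at hc
  set I := G.filter (fun e => e.1 = v ∨ e.2 = v) with hI
  have hIm : ∀ e ∈ F, e.1 ∈ S → e.2 ∈ S → (e.1 = v ∨ e.2 = v) → e ∈ I := by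
    intro e he h1 h2 h3
    simp only [hI, hG, Finset.mem_filter]
    exact ⟨⟨he, h1, h2⟩, h3⟩
  by_cases h2 : 2 ≤ I.card
  · exact ⟨A, hAS.trans (Finset.erase_subset _ _), hA, by omega⟩
  rcases I.eq_empty_or_nonempty with h0 | ⟨e₀, he₀⟩
  · have hvA : v ∉ A := fun h => by simpa using hAS h
    refine ⟨insert v A, ?_, ?_, ?_⟩
    · exact Finset.insert_subset hv (hAS.trans (Finset.erase_subset _ _))
    · rintro e he ⟨h1, h2⟩
      have hsub : insert v A ⊆ S :=
        Finset.insert_subset hv (hAS.trans (Finset.erase_subset _ _))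
      have hn : e ∉ I := by simp [h0]
      have := hA e he
      have := hIm e he (hsub h1) (hsub h2)
      simp only [Finset.mem_insert] at h1 h2
      tauto
    · rw [Finset.card_insert_of_notMem hvA]
      omega
  · have huniq : ∀ e ∈ I, e = e₀ := fun e he =>
      Finset.card_le_one.mp (by omega) e he e₀ he₀
    have hm : (e₀ ∈ F ∧ e₀.1 ∈ S ∧ e₀.2 ∈ S) ∧ (e₀.1 = v ∨ e₀.2 = v) := by
      simpa only [hI, hG, Finset.mem_filter] using he₀
    obtain ⟨u, huS, huv, hu⟩ : ∃ u ∈ S, u ≠ v ∧ (e₀.1 = u ∨ e₀.2 = u) := by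
      have := hl e₀ hm.1.1
      rcases hm.2 with h | h
      · exact ⟨e₀.2, hm.1.2.2, fun h' => this (h.trans h'.symm), Or.inr rfl⟩
      · exact ⟨e₀.1, hm.1.2.1, fun h' => this (h'.trans h.symm), Or.inl rfl⟩
    have hu' : u ∈ S.erase v := Finset.mem_erase.mpr ⟨huv, huS⟩
    have hce2 := Finset.card_erase_of_mem hu'
    have hpos2 : 0 < (S.erase v).card := Finset.card_pos.mpr ⟨u, hu'⟩
    obtain ⟨B, hBS, hB, hcB⟩ :=
      ih ((S.erase v).erase u).card (by omega) ((S.erase v).erase u) rfl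
    have hle : (F.filter (fun e => e.1 ∈ (S.erase v).erase u ∧ e.2 ∈ (S.erase v).erase u)).card
        ≤ (G.filter (fun e => ¬ (e.1 = v ∨ e.2 = v))).card := by
      apply Finset.card_le_card
      intro e
      simp only [hG, Finset.mem_filter, Finset.mem_erase]
      tauto
    have hIpos : 0 < I.card := Finset.card_pos.mpr ⟨e₀, he₀⟩
    have hvB : v ∉ B := fun h => by simpa using hBS h
    have huB : u ∉ B := fun h => by simpa using hBS h
    have hsub : insert v B ⊆ S :=
      Finset.insert_subset hv (hBS.trans ((Finset.erase_subset _ _).trans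
        (Finset.erase_subset _ _)))
    refine ⟨insert v B, hsub, ?_, ?_⟩
    · rintro e he ⟨h1, h2⟩
      have h3 := hB e he
      have h4 := hIm e he (hsub h1) (hsub h2)
      have huI : u ∉ insert v B := by simp [huv, huB]
      have hne : e ≠ e₀ := by
        rintro rfl
        rcases hu with h | h
        · exact huI (h ▸ h1)
        · exact huI (h ▸ h2)
      have h5 : ¬ (e.1 = v ∨ e.2 = v) := fun h => hne (huniq e (h4 h))
      simp only [Finset.mem_insert] at h1 h2
      tauto
    · rw [Finset.card_insert_of_notMem hvB]
      omega

/-- A digraph on `n` vertices with a feedback arc set of size `f` has an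
acyclic set of size at least `(2n - f) / 3`. -/
theorem acyclic_set_of_fas_greedy {V : Type*} [Fintype V] [DecidableEq V]
    (E F : Finset (V × V)) (hE : ∀ e ∈ E, e.1 ≠ e.2)
    (f : ℕ) (hFE : F ⊆ E) (hF : IsFAS E F) (hcard : F.card = f) :
    ∃ A : Finset V, IsAcyclicSet E A ∧
      (2 * (Fintype.card V : ℝ) - (f : ℝ)) / 3 ≤ (A.card : ℝ) := by
  obtain ⟨A, -, hA, hc⟩ := greedy_aux F (fun e he => hE e (hFE he)) _ Finset.univ rfl
  refine ⟨A, ?_, ?_⟩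
  · intro l hl hd
    obtain ⟨⟨a, b⟩, he, heF⟩ := hF l hd
    have h := List.of_mem_zip he
    exact hA _ heF ⟨hl _ h.1, hl _ (List.mem_rotate.mp h.2)⟩
  · simp only [Finset.mem_univ, and_self, Finset.filter_true, Finset.card_univ, hcard] at hc
    have : (2 * (Fintype.card V : ℝ)) ≤ 3 * A.card + f := by exact_mod_cast hc
    linarith
end

section
/- Let D be a digraph on n vertices with at most 3n − 6 edges in which every directed cycle has length at least g (g ≥ 1), and suppose that the minimum size of a feedback arc set of D equals the maximum number of pairwise arc-disjoint directed cycles of D (as holds for planar digraphs by the Lucchesi–Younger theorem). Then D has an acyclic set of size at least n − 3n/g. -/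
theorem cycleEdges_map_fst {V : Type*} (l : List V) : (cycleEdges l).map Prod.fst = l := by
  unfold cycleEdges
  exact List.map_fst_zip (by simp)

theorem cycleEdges_nodup {V : Type*} {l : List V} (h : l.Nodup) : (cycleEdges l).Nodup := by
  apply List.Nodup.of_map Prod.fst
  rwa [cycleEdges_map_fst]

theorem cycleEdges_length {V : Type*} (l : List V) : (cycleEdges l).length = l.length := by
  simp [cycleEdges]

theorem packing_bound {V : Type*} [DecidableEq V] (E : Finset (V × V)) (g : ℕ)
    (hgirth : ∀ l : List V, IsDicycle E l → g ≤ l.length)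
    (H : Finset (List V)) (hH : ∀ l ∈ H, IsDicycle E l)
    (hd : (H : Set (List V)).Pairwise
               (fun l l' => ∀ e ∈ cycleEdges l, e ∉ cycleEdges l')) :
    H.card * g ≤ E.card := by
  have h1 : (H.biUnion fun l => (cycleEdges l).toFinset).card
      = ∑ l ∈ H, (cycleEdges l).toFinset.card := by
    apply Finset.card_biUnion
    intro l hl l' hl' hne
    refine Finset.disjoint_left.2 ?_
    intro e he he'
    exact hd hl hl' hne e (List.mem_toFinset.1 he) (List.mem_toFinset.1 he')
  have h2 : (H.biUnion fun l => (cycleEdges l).toFinset) ⊆ E := by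
    intro e he
    obtain ⟨l, hl, hel⟩ := Finset.mem_biUnion.1 he
    exact (hH l hl).2.2 e (List.mem_toFinset.1 hel)
  have h3 : H.card * g ≤ ∑ l ∈ H, (cycleEdges l).toFinset.card := by
    rw [← smul_eq_mul]
    apply Finset.card_nsmul_le_sum
    intro l hl
    rw [List.toFinset_card_of_nodup (cycleEdges_nodup (hH l hl).2.1), cycleEdges_length]
    exact hgirth l (hH l hl)
  exact h3.trans (h1 ▸ Finset.card_le_card h2)

/-- A digraph on `n` vertices with at most `3n - 6` edges, in which every
directed cycle has length at least `g ≥ 1`, and which has the Lucchesi–Younger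
property (min feedback arc set = max arc-disjoint cycle packing), has an
acyclic set of size at least `n - 3n/g`. -/
theorem acyclic_set_of_digirth {V : Type*} [Fintype V] [DecidableEq V]
    (E : Finset (V × V)) (hE : ∀ e ∈ E, e.1 ≠ e.2)
    (hm : (E.card : ℤ) ≤ 3 * (Fintype.card V : ℤ) - 6)
    (g : ℕ) (hg : 1 ≤ g)
    (hgirth : ∀ l : List V, IsDicycle E l → g ≤ l.length)
    (hLY : sInf {k : ℕ | ∃ F : Finset (V × V), F ⊆ E ∧ IsFAS E F ∧ F.card = k} =
           sSup {k : ℕ | ∃ H : Finset (List V), (∀ l ∈ H, IsDicycle E l) ∧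
             (H : Set (List V)).Pairwise
               (fun l l' => ∀ e ∈ cycleEdges l, e ∉ cycleEdges l') ∧
             H.card = k}) :
    ∃ A : Finset V, IsAcyclicSet E A ∧
      (Fintype.card V : ℝ) - 3 * (Fintype.card V : ℝ) / g ≤ (A.card : ℝ) := by
  have hne : {k : ℕ | ∃ F : Finset (V × V), F ⊆ E ∧ IsFAS E F ∧ F.card = k}.Nonempty := by
    refine ⟨E.card, E, subset_rfl, ?_, rfl⟩
    intro l hl
    have hlen : (cycleEdges l) ≠ [] := by
      intro h
      have := cycleEdges_length l
      rw [h] at this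
      exact hl.1 (List.length_eq_zero_iff.1 this.symm)
    obtain ⟨e, he⟩ := List.exists_mem_of_ne_nil _ hlen
    exact ⟨e, he, hl.2.2 e he⟩
  obtain ⟨F, -, hF, hFc⟩ := Nat.sInf_mem hne
  rw [hLY] at hFc
  have hk : F.card ≤ E.card / g := by
    rw [hFc]
    apply csSup_le
    · exact ⟨0, ∅, by simp, by simp, rfl⟩
    · rintro k ⟨H, hH, hd, rfl⟩
      exact (Nat.le_div_iff_mul_le (by omega)).2 (packing_bound E g hgirth H hH hd)
  rw [Nat.le_div_iff_mul_le (by omega)] at hk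
  refine ⟨Finset.univ \ F.image Prod.fst, ?_, ?_⟩
  · intro l hl hc
    obtain ⟨e, he, heF⟩ := hF l hc
    have h1 : e.1 ∈ l := by
      have := List.mem_map_of_mem (f := Prod.fst) he
      rwa [cycleEdges_map_fst] at this
    exact (Finset.mem_sdiff.1 (hl _ h1)).2 (Finset.mem_image_of_mem _ heF)
  · have h1 : Fintype.card V ≤ (Finset.univ \ F.image Prod.fst).card + F.card := by
      have h2 := Finset.le_card_sdiff (F.image Prod.fst) (Finset.univ : Finset V)
      have h3 : (F.image Prod.fst).card ≤ F.card := Finset.card_image_le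
      rw [Finset.card_univ] at h2
      omega
    have h4 : F.card * g ≤ 3 * Fintype.card V := by omega
    have h5 : (F.card : ℝ) ≤ 3 * (Fintype.card V : ℝ) / g := by
      rw [le_div_iff₀ (by exact_mod_cast hg)]
      exact_mod_cast h4
    have h6 : (Fintype.card V : ℝ) ≤ ((Finset.univ \ F.image Prod.fst).card : ℝ) + F.card := by
      exact_mod_cast h1
    linarith
end

section
/- Let D be a digraph on n vertices with at most 3n − 6 edges in which every directed cycle has length at least 4, and suppose that the minimum size of a feedback arc set of D equals the maximum number of pairwise arc-disjoint directed cycles of D (as holds for planar digraphs by the Lucchesi–Younger theorem). Then D has an acyclic set of size at least 5n/12. -/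
/-- A loopless digraph with edge set `F` has an independent set of size at least
`(2 |S| - |F[S]|) / 3` inside every vertex set `S`. -/
theorem exists_indep_aux {V : Type*} [DecidableEq V] (F : Finset (V × V))
    (hF : ∀ e ∈ F, e.1 ≠ e.2) (n : ℕ) : ∀ S : Finset V, S.card = n →
    ∃ A ⊆ S, (∀ e ∈ F, ¬ (e.1 ∈ A ∧ e.2 ∈ A)) ∧
      2 * S.card ≤ 3 * A.card + (F.filter (fun e => e.1 ∈ S ∧ e.2 ∈ S)).card := by
  induction n using Nat.strong_induction_on with
  | _ n ih =>
  intro S hS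
  rcases S.eq_empty_or_nonempty with rfl | ⟨v, hv⟩
  · exact ⟨∅, by simp, by simp, by simp⟩
  set G := F.filter (fun e => e.1 ∈ S ∧ e.2 ∈ S) with hG
  set I := G.filter (fun e => e.1 = v ∨ e.2 = v) with hI
  have hsplit : I.card + (G.filter (fun e => ¬ (e.1 = v ∨ e.2 = v))).card = G.card :=
    Finset.card_filter_add_card_filter_not _
  -- removing a set containing `v` removes all edges of `I`
  have hdel : ∀ T : Finset V, v ∉ T → T ⊆ S →
      (F.filter (fun e => e.1 ∈ T ∧ e.2 ∈ T)).card + I.card ≤ G.card := by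
    intro T hvT hTS
    have : (F.filter (fun e => e.1 ∈ T ∧ e.2 ∈ T)) ⊆
        G.filter (fun e => ¬ (e.1 = v ∨ e.2 = v)) := by
      intro e he
      simp only [hG, Finset.mem_filter] at he ⊢
      refine ⟨⟨he.1, hTS he.2.1, hTS he.2.2⟩, ?_⟩
      rintro (h | h)
      · exact hvT (h ▸ he.2.1)
      · exact hvT (h ▸ he.2.2)
    have := Finset.card_le_card this
    omega
  have hpos : 0 < S.card := Finset.card_pos.mpr ⟨v, hv⟩
  have herase : (S.erase v).card = S.card - 1 := Finset.card_erase_of_mem hv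
  by_cases h2 : 2 ≤ I.card
  · obtain ⟨A, hAS, hA, hc⟩ := ih (S.erase v).card (by omega) (S.erase v) rfl
    have := hdel (S.erase v) (by simp) (Finset.erase_subset _ _)
    exact ⟨A, hAS.trans (Finset.erase_subset _ _), hA, by omega⟩
  -- otherwise `v` has at most one neighbour
  have key : ∃ T ⊆ S.erase v, (∀ e ∈ I, ¬ (e.1 ∈ insert v T ∧ e.2 ∈ insert v T)) ∧
      S.card ≤ T.card + 1 + I.card := by
    rcases Nat.lt_or_ge I.card 1 with h0 | h1
    · have hI0 : I = ∅ := Finset.card_eq_zero.mp (by omega)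
      exact ⟨S.erase v, subset_rfl, by simp [hI0], by omega⟩
    · have h1' : I.card = 1 := by omega
      obtain ⟨e, he⟩ := Finset.card_eq_one.mp h1'
      have heI : e ∈ I := by simp [he]
      have heI' := heI
      simp only [hI, hG, Finset.mem_filter] at heI'
      have hne := hF e heI'.1.1
      have hex : ∃ w, w ≠ v ∧ (e.1 = w ∨ e.2 = w) := by
        rcases heI'.2 with h | h
        · exact ⟨e.2, fun h' => hne (h.trans h'.symm), Or.inr rfl⟩
        · exact ⟨e.1, fun h' => hne (h'.trans h.symm), Or.inl rfl⟩
      obtain ⟨w, hwv, hw⟩ := hex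
      refine ⟨(S.erase v).erase w, Finset.erase_subset _ _, ?_, ?_⟩
      · intro e' he'
        rw [he, Finset.mem_singleton] at he'
        subst he'
        rintro ⟨ha, hb⟩
        rcases hw with h | h
        · rw [h] at ha; simp [hwv] at ha
        · rw [h] at hb; simp [hwv] at hb
      · have := Finset.pred_card_le_card_erase (s := S.erase v) (a := w)
        omega
  obtain ⟨T, hTS, hT, hTc⟩ := key
  have hvT : v ∉ T := fun h => by simpa using hTS h
  have hTc' := Finset.card_le_card hTS
  obtain ⟨A, hAT, hA, hc⟩ := ih T.card (by omega) T rfl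
  have hvA : v ∉ A := fun h => hvT (hAT h)
  have hTS' : T ⊆ S := hTS.trans (Finset.erase_subset _ _)
  have hd := hdel T hvT hTS'
  have hsub : insert v A ⊆ insert v T := Finset.insert_subset_insert _ hAT
  have hsub' : insert v T ⊆ S := Finset.insert_subset hv hTS'
  refine ⟨insert v A, hsub.trans hsub', ?_, ?_⟩
  · rintro e he ⟨ha, hb⟩
    by_cases hev : e.1 = v ∨ e.2 = v
    · refine hT e ?_ ⟨hsub ha, hsub hb⟩
      simp only [hI, hG, Finset.mem_filter]
      exact ⟨⟨he, hsub' (hsub ha), hsub' (hsub hb)⟩, hev⟩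
    · push Not at hev
      exact hA e he ⟨Finset.mem_of_mem_insert_of_ne ha hev.1,
        Finset.mem_of_mem_insert_of_ne hb hev.2⟩
  · rw [Finset.card_insert_of_notMem hvA]
    omega

theorem cycleEdges_mem {V : Type*} {l : List V} {e : V × V} (he : e ∈ cycleEdges l) :
    e.1 ∈ l ∧ e.2 ∈ l := by
  have := List.of_mem_zip (a := e.1) (b := e.2) he
  simpa using this

theorem packing_card_le {V : Type*} [DecidableEq V] (E : Finset (V × V))
    (hgirth : ∀ l : List V, IsDicycle E l → 4 ≤ l.length)
    (H : Finset (List V)) (hH : ∀ l ∈ H, IsDicycle E l)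
    (hP : (H : Set (List V)).Pairwise
      (fun l l' => ∀ e ∈ cycleEdges l, e ∉ cycleEdges l')) : 4 * H.card ≤ E.card := by
  have hsub : H.biUnion (fun l => (cycleEdges l).toFinset) ⊆ E := by
    intro e he
    simp only [Finset.mem_biUnion, List.mem_toFinset] at he
    obtain ⟨l, hl, he⟩ := he
    exact (hH l hl).2.2 e he
  have hcard : (H.biUnion (fun l => (cycleEdges l).toFinset)).card =
      ∑ l ∈ H, (cycleEdges l).toFinset.card := by
    apply Finset.card_biUnion
    intro l hl l' hl' hne
    rw [Function.onFun, Finset.disjoint_left]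
    intro e he he'
    exact hP hl hl' hne e (by simpa using he) (by simpa using he')
  have hge : H.card * 4 ≤ ∑ l ∈ H, (cycleEdges l).toFinset.card := by
    rw [← smul_eq_mul]
    apply Finset.card_nsmul_le_sum
    intro l hl
    have hnd : (cycleEdges l).Nodup :=
      List.Nodup.of_map Prod.fst (by rw [cycleEdges_map_fst]; exact (hH l hl).2.1)
    rw [List.toFinset_card_of_nodup hnd, cycleEdges_length]
    exact hgirth l (hH l hl)
  have := Finset.card_le_card hsub
  omega

/-- A digraph on `n` vertices with at most `3n - 6` edges, in which every
directed cycle has length at least `4`, and which has the Lucchesi–Younger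
property (min feedback arc set = max arc-disjoint cycle packing), has an
acyclic set of size at least `5n/12`. -/
theorem acyclic_set_of_digirth_four {V : Type*} [Fintype V] [DecidableEq V]
    (E : Finset (V × V)) (hE : ∀ e ∈ E, e.1 ≠ e.2)
    (hm : (E.card : ℤ) ≤ 3 * (Fintype.card V : ℤ) - 6)
    (hgirth : ∀ l : List V, IsDicycle E l → 4 ≤ l.length)
    (hLY : sInf {k : ℕ | ∃ F : Finset (V × V), F ⊆ E ∧ IsFAS E F ∧ F.card = k} =
           sSup {k : ℕ | ∃ H : Finset (List V), (∀ l ∈ H, IsDicycle E l) ∧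
             (H : Set (List V)).Pairwise
               (fun l l' => ∀ e ∈ cycleEdges l, e ∉ cycleEdges l') ∧
             H.card = k}) :
    ∃ A : Finset V, IsAcyclicSet E A ∧
      5 * (Fintype.card V : ℝ) / 12 ≤ (A.card : ℝ) := by
  have hne : {k : ℕ | ∃ F : Finset (V × V), F ⊆ E ∧ IsFAS E F ∧ F.card = k}.Nonempty := by
    refine ⟨E.card, E, subset_rfl, ?_, rfl⟩
    intro l hl
    have : cycleEdges l ≠ [] := by
      intro h
      apply hl.1
      rw [← cycleEdges_map_fst l, h, List.map_nil]
    obtain ⟨e, he⟩ := List.exists_mem_of_ne_nil _ this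
    exact ⟨e, he, hl.2.2 e he⟩
  obtain ⟨F, hFE, hFAS, hFc⟩ := Nat.sInf_mem hne
  have hle : F.card ≤ E.card / 4 := by
    rw [hFc, hLY]
    apply csSup_le
    · exact ⟨0, ∅, by simp, by simp, rfl⟩
    · rintro k ⟨H, hH, hP, rfl⟩
      have := packing_card_le E hgirth H hH hP
      omega
  obtain ⟨A, -, hA, hc⟩ := exists_indep_aux F (fun e he => hE e (hFE he)) _ Finset.univ rfl
  refine ⟨A, ?_, ?_⟩
  · intro l hl hcyc
    obtain ⟨e, he, heF⟩ := hFAS l hcyc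
    have := cycleEdges_mem he
    exact hA e heF ⟨hl _ this.1, hl _ this.2⟩
  · have h1 : (F.filter (fun e => e.1 ∈ Finset.univ ∧ e.2 ∈ Finset.univ)).card ≤ F.card :=
      Finset.card_filter_le _ _
    rw [Finset.card_univ] at hc
    have h2 : 5 * Fintype.card V ≤ 12 * A.card := by omega
    have h3 : (5 * Fintype.card V : ℝ) ≤ 12 * A.card := by exact_mod_cast h2
    linarith
end

section
/- There exists an oriented graph D (on a finite vertex set) such that for every minimum feedback arc set F of D and for every vertex cover Y of F, the subdigraph of D induced by Y contains a directed cycle. -/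
/-- Edge set of the Paley tournament on seven vertices. -/
def paleyE : Finset (Fin 7 × Fin 7) :=
  Finset.univ.filter fun e => e.2 = e.1 + 1 ∨ e.2 = e.1 + 2 ∨ e.2 = e.1 + 4

/-- Every 2-colouring of the Paley tournament has a monochromatic directed triangle. -/
lemma paley_mono_bool : ∀ b0 b1 b2 b3 b4 b5 b6 : Bool,
    ∃ i : Fin 7, ∃ s : Fin 7, (s = 1 ∨ s = 2) ∧
      ![b0, b1, b2, b3, b4, b5, b6] i = ![b0, b1, b2, b3, b4, b5, b6] (i + s) ∧
      ![b0, b1, b2, b3, b4, b5, b6] i = ![b0, b1, b2, b3, b4, b5, b6] (i + 3) := by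
  decide +kernel

lemma paley_mono (p : Fin 7 → Bool) :
    ∃ i : Fin 7, ∃ s : Fin 7, (s = 1 ∨ s = 2) ∧ p i = p (i + s) ∧ p i = p (i + 3) := by
  have hp : ![p 0, p 1, p 2, p 3, p 4, p 5, p 6] = p := by
    ext i; fin_cases i <;> rfl
  have h := paley_mono_bool (p 0) (p 1) (p 2) (p 3) (p 4) (p 5) (p 6)
  rwa [hp] at h

lemma paley_triangle : ∀ i s : Fin 7, (s = 1 ∨ s = 2) →
    [i, i + s, i + 3].Nodup ∧ ∀ e ∈ [i, i + s, i + 3].zip [i + s, i + 3, i], e ∈ paleyE := by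
  decide +kernel

/-- There exists an oriented graph (a loopless digraph with at most one edge
between any pair of vertices) such that for every minimum feedback arc set `F`
and every vertex cover `Y` of `F`, the subdigraph induced by `Y` contains a
directed cycle. -/
theorem exists_bad_oriented_graph :
    ∃ (V : Type) (_ : Fintype V) (_ : DecidableEq V) (E : Finset (V × V)),
      (∀ e ∈ E, e.1 ≠ e.2) ∧
      (∀ e ∈ E, (e.2, e.1) ∉ E) ∧
      ∀ F : Finset (V × V), F ⊆ E → IsFAS E F →
        (∀ F' : Finset (V × V), F' ⊆ E → IsFAS E F' → F.card ≤ F'.card) →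
        ∀ Y : Finset V, (∀ e ∈ F, e.1 ∈ Y ∨ e.2 ∈ Y) →
          ∃ l : List V, (∀ v ∈ l, v ∈ Y) ∧ IsDicycle E l := by
  classical
  refine ⟨Fin 7, inferInstance, inferInstance, paleyE, by decide +kernel, by decide +kernel, ?_⟩
  intro F _ hF _ Y hY
  obtain ⟨i, s, hs, h1, h2⟩ := paley_mono (fun v => decide (v ∈ Y))
  obtain ⟨hn, he⟩ := paley_triangle i s hs
  have hc : IsDicycle paleyE [i, i + s, i + 3] := ⟨by simp, hn, he⟩
  simp only [decide_eq_decide] at h1 h2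
  by_cases hi : i ∈ Y
  · refine ⟨_, ?_, hc⟩
    intro v hv
    simp only [List.mem_cons, List.not_mem_nil, or_false] at hv
    rcases hv with rfl | rfl | rfl
    · exact hi
    · exact h1.1 hi
    · exact h2.1 hi
  · exfalso
    have hj : i + s ∉ Y := fun h => hi (h1.2 h)
    have hk : i + 3 ∉ Y := fun h => hi (h2.2 h)
    obtain ⟨e, hel, heF⟩ := hF _ hc
    have hy := hY e heF
    change e ∈ [(i, i + s), (i + s, i + 3), (i + 3, i)] at hel
    simp only [List.mem_cons, List.not_mem_nil, or_false] at hel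
    rcases hel with rfl | rfl | rfl <;> simp_all
end
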